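/- (Fresnel polynomial of generalized Q-media.) Let g = diag(−1,1,1,1), with entries written g^{ij} = g_{ij}, let C₁, C₂, ρ ∈ ℝ and let A be a bivector. Define the medium tensor κ^{ij}_{rs} = C₁ g^{ia} g^{jb} ε_{abrs} + ρ ε_{rsab} A^{ab} A^{ij} + C₂ (δ^i_r δ^j_s − δ^i_s δ^j_r). Then the Fresnel polynomial of κ satisfies, for all ξ ∈ ℝ⁴, G(ξ) = −C₁² · (g^{ij} ξ_i ξ_j) · (H^{ij} ξ_i ξ_j), where H^{ij} = C₁ g^{ij} − 2ρ A^{ia} g_{ab} A^{bj}. -/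

import Mathlib

noncomputable section
open Matrix BigOperators

/-- Medium tensor components `κ^{ij}_{rs}` on ℝ⁴ (upper indices first). -/
abbrev MT := Fin 4 → Fin 4 → Fin 4 → Fin 4 → ℝ

/-- Bivector (or 2-form) components on ℝ⁴. -/
abbrev BV := Fin 4 → Fin 4 → ℝ

/-- Totally antisymmetric Levi-Civita symbol on {0,1,2,3} with ε₀₁₂₃ = 1. -/
def eps (i j k l : Fin 4) : ℝ :=
  ((j.val : ℝ) - i.val) * ((k.val : ℝ) - i.val) * ((l.val : ℝ) - i.val) *
    ((k.val : ℝ) - j.val) * ((l.val : ℝ) - j.val) * ((l.val : ℝ) - k.val) / 12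

/-- Identity medium tensor `Id^{ij}_{rs} = δ^i_r δ^j_s − δ^i_s δ^j_r`. -/
def idT : MT := fun i j r s =>
  (if i = r then (1 : ℝ) else 0) * (if j = s then 1 else 0) -
    (if i = s then 1 else 0) * (if j = r then 1 else 0)

/-- Composition `(κ∘η)^{ij}_{rs} = (1/2) κ^{ab}_{rs} η^{ij}_{ab}`. -/
def compT (κ η : MT) : MT := fun i j r s => (1 / 2) * ∑ a, ∑ b, κ a b r s * η i j a b

/-- Poincaré adjoint `κ̄^{ij}_{rs} = (1/4) ε_{rsab} κ^{ab}_{cd} ε^{cdij}`. -/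
def adjT (κ : MT) : MT := fun i j r s =>
  (1 / 4) * ∑ a, ∑ b, ∑ c, ∑ d, eps r s a b * κ a b c d * eps c d i j

/-- Trace `tr κ = (1/2) κ^{ij}_{ij}`. -/
def traceT (κ : MT) : ℝ := (1 / 2) * ∑ i, ∑ j, κ i j i j

def antisymBV (A : BV) : Prop := ∀ i j, A i j = - A j i

def antisymMT (κ : MT) : Prop :=
  (∀ i j r s, κ i j r s = - κ j i r s) ∧ (∀ i j r s, κ i j r s = - κ i j s r)

/-- The medium tensor `(ρ Ā⊗B)^{ij}_{rs} = ρ ε_{rsab} A^{ab} B^{ij}`. -/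
def tensAB (ρ : ℝ) (A B : BV) : MT := fun i j r s =>
  ρ * (∑ a, ∑ b, eps r s a b * A a b) * B i j

/-- Hodge star `(∗_g)^{ij}_{rs} = √|det g| g^{ia} g^{jb} ε_{abrs}`. -/
def hodge (g : Matrix (Fin 4) (Fin 4) ℝ) : MT := fun i j r s =>
  Real.sqrt |g.det| * ∑ a, ∑ b, g⁻¹ i a * g⁻¹ j b * eps a b r s

/-- The (non-symmetrised) Fresnel tensor density `𝒢₀^{ijkl}`. -/
def G0 (κ : MT) (i j k l : Fin 4) : ℝ :=
  (1 / 48) * ∑ a₁, ∑ a₂, ∑ a₃, ∑ a₄, ∑ b₁, ∑ b₂, ∑ b₃, ∑ b₄, ∑ b₅, ∑ b₆,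
    κ a₁ a₂ b₁ b₂ * κ a₃ i b₃ b₄ * κ a₄ j b₅ b₆ *
      eps b₁ b₂ b₅ k * eps b₃ b₄ b₆ l * eps a₁ a₂ a₃ a₄

/-- Fresnel polynomial `G(ξ) = 𝒢₀^{ijkl} ξ_i ξ_j ξ_k ξ_l`. -/
def fresnel (κ : MT) (ξ : Fin 4 → ℝ) : ℝ :=
  ∑ i, ∑ j, ∑ k, ∑ l, G0 κ i j k l * ξ i * ξ j * ξ k * ξ l

/-- A Lorentz metric: real symmetric invertible 4×4 matrix of signature
(−+++) or (+−−−), equivalently symmetric with negative determinant. -/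
def IsLorentz (g : Matrix (Fin 4) (Fin 4) ℝ) : Prop := g.IsSymm ∧ g.det < 0

/-- Null cone `N(g) = {ξ : g^{ij} ξ_i ξ_j = 0}` (on covectors, via the inverse metric). -/
def nullCone (g : Matrix (Fin 4) (Fin 4) ℝ) : Set (Fin 4 → ℝ) :=
  {ξ | ∑ i, ∑ j, g⁻¹ i j * ξ i * ξ j = 0}

/-- The ordering O = (01, 02, 03, 23, 31, 12) of index pairs. -/
def pairs : Fin 6 → Fin 4 × Fin 4 := ![(0, 1), (0, 2), (0, 3), (2, 3), (3, 1), (1, 2)]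

/-- The 6×6 matrix representing a medium tensor: `M_{IJ} = κ^{J₁J₂}_{I₁I₂}`. -/
def mat6 (κ : MT) : Matrix (Fin 6) (Fin 6) ℝ := fun I J =>
  κ (pairs J).1 (pairs J).2 (pairs I).1 (pairs I).2

/-- The Fresnel surface decomposes into a double light cone. -/
def DoubleCone (κ : MT) : Prop :=
  ∃ gp gm, IsLorentz gp ∧ IsLorentz gm ∧ nullCone gp ≠ nullCone gm ∧
    {ξ | fresnel κ ξ = 0} = nullCone gp ∪ nullCone gm

/-- The Minkowski metric diag(−1,1,1,1), with g^{ij} = g_{ij}. -/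
def gmink : Matrix (Fin 4) (Fin 4) ℝ := fun i j =>
  if i = j then (if i = 0 then -1 else 1) else 0

/-- The contraction `κ^{ai}_{bc} ξ_i` of a medium tensor with a covector. -/
def contrMT (κ : MT) (ξ : Fin 4 → ℝ) (a b c : Fin 4) : ℝ := ∑ i, κ a i b c * ξ i

/-- The contraction `ε^{abci} ξ_i`. -/
def contrEps (ξ : Fin 4 → ℝ) (a b c : Fin 4) : ℝ := ∑ i, eps a b c i * ξ i

lemma fresnel_eq_sum_contr (κ : MT) (ξ : Fin 4 → ℝ) :
    fresnel κ ξ = (1 / 48) * ∑ a, ∑ b, ∑ c, ∑ d,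
      (∑ p, ∑ q, ∑ r, ∑ s, κ p q r s * contrEps ξ r s c * eps p q a b) *
        (∑ r, ∑ s, contrMT κ ξ a r s * contrEps ξ r s d) * contrMT κ ξ b c d := by
  simp only [fresnel, G0, contrMT, contrEps, Finset.mul_sum, Finset.sum_mul,
    ← Fintype.sum_prod_type']
  refine Fintype.sum_equiv
    ⟨fun (i, j, k, l, a₁, a₂, a₃, a₄, b₁, b₂, b₃, b₄, b₅, b₆) =>
        (a₃, a₄, b₅, b₆, j, (b₃, b₄, l, i), a₁, a₂, b₁, b₂, k),
      fun (a₃, a₄, b₅, b₆, j, (b₃, b₄, l, i), a₁, a₂, b₁, b₂, k) =>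
        (i, j, k, l, a₁, a₂, a₃, a₄, b₁, b₂, b₃, b₄, b₅, b₆),
      fun _ => rfl, fun _ => rfl⟩ _ _ fun _ => ?_
  simp only [Equiv.coe_fn_mk]
  ring

/-- The Levi-Civita symbol as an integer. -/
def epsInt (i j k l : Fin 4) : ℤ :=
  ((j.val : ℤ) - i.val) * ((k.val : ℤ) - i.val) * ((l.val : ℤ) - i.val) *
    ((k.val : ℤ) - j.val) * ((l.val : ℤ) - j.val) * ((l.val : ℤ) - k.val) / 12

lemma eps_eq_epsInt (i j k l : Fin 4) : eps i j k l = epsInt i j k l := by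
  have h : ∀ i j k l : Fin 4, 12 * epsInt i j k l =
      ((j.val : ℤ) - i.val) * ((k.val : ℤ) - i.val) * ((l.val : ℤ) - i.val) *
        ((k.val : ℤ) - j.val) * ((l.val : ℤ) - j.val) * ((l.val : ℤ) - k.val) := by
    decide +kernel
  have h' := congrArg (Int.cast : ℤ → ℝ) (h i j k l)
  push_cast at h'
  rw [eps, ← h']
  ring

lemma sum_eps_mul_eps (a b c d : Fin 4) :
    ∑ r, ∑ s, eps a b r s * eps r s c d = 2 * idT a b c d := by
  have h : ∀ a b c d : Fin 4, ∑ r, ∑ s, epsInt a b r s * epsInt r s c d =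
      2 * ((if a = c then 1 else 0) * (if b = d then 1 else 0) -
        (if a = d then 1 else 0) * (if b = c then 1 else 0)) := by
    decide +kernel
  simp only [eps_eq_epsInt, idT]
  exact_mod_cast congrArg (Int.cast : ℤ → ℝ) (h a b c d)

lemma eps_swap_pairs (a b c d : Fin 4) : eps a b c d = eps c d a b := by
  simp only [eps]; ring

lemma eps_swap_left (a b c d : Fin 4) : eps a b c d = -eps b a c d := by
  simp only [eps]; ring

lemma sum_eps_mul_contrEps (ξ : Fin 4 → ℝ) (a b c : Fin 4) :
    ∑ r, ∑ s, eps a b r s * contrEps ξ r s c =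
      2 * ((if a = c then 1 else 0) * ξ b - (if b = c then 1 else 0) * ξ a) := by
  calc ∑ r, ∑ s, eps a b r s * contrEps ξ r s c
      = ∑ i, (∑ r, ∑ s, eps a b r s * eps r s c i) * ξ i := by
        simp only [contrEps, Finset.mul_sum, Finset.sum_mul, ← Fintype.sum_prod_type']
        refine Fintype.sum_equiv ⟨fun (r, s, i) => (i, r, s), fun (i, r, s) => (r, s, i),
          fun _ => rfl, fun _ => rfl⟩ _ _ fun _ => ?_
        simp only [Equiv.coe_fn_mk]
        ring
    _ = _ := by
        simp only [sum_eps_mul_eps, idT]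
        simp [mul_sub, sub_mul, Finset.sum_sub_distrib]

/-- The dual `ε_{abcd} A^{cd}` of a bivector. -/
def dualBV (A : BV) (a b : Fin 4) : ℝ := ∑ c, ∑ d, eps a b c d * A c d

/-- The contraction `A^{ai} ξ_i` of a bivector with a covector. -/
def contrBV (A : BV) (ξ : Fin 4 → ℝ) (a : Fin 4) : ℝ := ∑ i, A a i * ξ i

/-- The diagonal of the Minkowski metric. -/
def sgn (i : Fin 4) : ℝ := if i = 0 then -1 else 1

/-- The medium tensor of a generalized Q-medium over the Minkowski metric. -/
def qMedium (C₁ C₂ ρ : ℝ) (A : BV) : MT := fun i j r s =>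
  C₁ * (∑ a, ∑ b, gmink i a * gmink j b * eps a b r s) +
    ρ * (∑ a, ∑ b, eps r s a b * A a b) * A i j + C₂ * idT i j r s

lemma gmink_eq (i j : Fin 4) : gmink i j = if i = j then sgn i else 0 := rfl

lemma qMedium_apply (C₁ C₂ ρ : ℝ) (A : BV) (i j r s : Fin 4) :
    qMedium C₁ C₂ ρ A i j r s =
      C₁ * (sgn i * sgn j * eps i j r s) + ρ * (dualBV A r s * A i j) + C₂ * idT i j r s := by
  simp [qMedium, dualBV, gmink_eq, mul_assoc]

lemma contrMT_qMedium (C₁ C₂ ρ : ℝ) (A : BV) (ξ : Fin 4 → ℝ) (a b c : Fin 4) :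
    contrMT (qMedium C₁ C₂ ρ A) ξ a b c =
      C₁ * (sgn a * ∑ i, sgn i * ξ i * eps a i b c) + ρ * (dualBV A b c * contrBV A ξ a) +
        C₂ * ((if a = b then 1 else 0) * ξ c - (if a = c then 1 else 0) * ξ b) := by
  simp only [contrMT, qMedium_apply, contrBV, idT, add_mul, Finset.sum_add_distrib]
  congr 1
  · congr 1
    · simp only [Finset.mul_sum]
      exact Finset.sum_congr rfl fun _ _ => by ring
    · simp only [Finset.mul_sum]
      exact Finset.sum_congr rfl fun _ _ => by ring
  · simp [mul_assoc, ← Finset.mul_sum, sub_mul]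

lemma sum_dualBV_mul_contrEps {A : BV} (hA : antisymBV A) (ξ : Fin 4 → ℝ) (c : Fin 4) :
    ∑ r, ∑ s, dualBV A r s * contrEps ξ r s c = 4 * contrBV A ξ c := by
  calc ∑ r, ∑ s, dualBV A r s * contrEps ξ r s c
      = ∑ a, ∑ b, A a b * ∑ r, ∑ s, eps a b r s * contrEps ξ r s c := by
        simp only [dualBV, Finset.mul_sum, Finset.sum_mul, ← Fintype.sum_prod_type']
        refine Fintype.sum_equiv ⟨fun (r, s, a, b) => (a, b, r, s),
          fun (a, b, r, s) => (r, s, a, b), fun _ => rfl, fun _ => rfl⟩ _ _ fun x => ?_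
        simp only [Equiv.coe_fn_mk]
        rw [eps_swap_pairs]
        ring
    _ = ∑ b, (2 * A c b * ξ b - 2 * A b c * ξ b) := by
        simp only [sum_eps_mul_contrEps]
        fin_cases c <;> simp [Fin.sum_univ_four] <;> ring
    _ = _ := by
        simp only [contrBV, Finset.mul_sum]
        exact Finset.sum_congr rfl fun b _ => by rw [hA b c]; ring

lemma sum_eps_mul_sum_eps_mul_contrEps (ξ : Fin 4 → ℝ) (a d : Fin 4) :
    ∑ r, ∑ s, (∑ i, sgn i * ξ i * eps a i r s) * contrEps ξ r s d =
      2 * ((if a = d then 1 else 0) * ∑ i, sgn i * ξ i ^ 2 - sgn d * ξ d * ξ a) := by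
  calc ∑ r, ∑ s, (∑ i, sgn i * ξ i * eps a i r s) * contrEps ξ r s d
      = ∑ i, sgn i * ξ i * ∑ r, ∑ s, eps a i r s * contrEps ξ r s d := by
        simp only [Finset.mul_sum, Finset.sum_mul, ← Fintype.sum_prod_type']
        refine Fintype.sum_equiv ⟨fun (r, s, i) => (i, r, s),
          fun (i, r, s) => (r, s, i), fun _ => rfl, fun _ => rfl⟩ _ _ fun x => ?_
        simp only [Equiv.coe_fn_mk]
        ring
    _ = _ := by
        simp only [sum_eps_mul_contrEps]
        fin_cases a <;> fin_cases d <;> simp [Fin.sum_univ_four] <;> ring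

lemma sum_contrMT_qMedium_mul_contrEps {A : BV} (hA : antisymBV A) (C₁ C₂ ρ : ℝ) (ξ : Fin 4 → ℝ)
    (a d : Fin 4) :
    ∑ r, ∑ s, contrMT (qMedium C₁ C₂ ρ A) ξ a r s * contrEps ξ r s d =
      2 * C₁ * (sgn a * ((if a = d then 1 else 0) * ∑ i, sgn i * ξ i ^ 2 - sgn d * ξ d * ξ a)) +
        4 * ρ * (contrBV A ξ a * contrBV A ξ d) := by
  have hX : ∀ r s, contrEps ξ r s d = -contrEps ξ s r d := fun r s => by
    simp only [contrEps, eps_swap_left r s, neg_mul, Finset.sum_neg_distrib]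
  have hξ : ∀ r, ∑ s, ξ s * contrEps ξ r s d = 0 := fun r => by
    fin_cases r <;> fin_cases d <;> simp [contrEps, eps, Fin.sum_univ_four] <;> ring
  have hδ : ∑ r, ∑ s, ((if a = r then 1 else 0) * ξ s - (if a = s then 1 else 0) * ξ r) *
      contrEps ξ r s d = 0 := by
    have h : ∑ r, ξ r * contrEps ξ r a d = 0 := by
      simpa [hX _ a] using hξ a
    simp [sub_mul, Finset.sum_sub_distrib, hξ, h]
  calc ∑ r, ∑ s, contrMT (qMedium C₁ C₂ ρ A) ξ a r s * contrEps ξ r s d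
      = C₁ * sgn a * (∑ r, ∑ s, (∑ i, sgn i * ξ i * eps a i r s) * contrEps ξ r s d) +
          ρ * contrBV A ξ a * (∑ r, ∑ s, dualBV A r s * contrEps ξ r s d) +
          C₂ * ∑ r, ∑ s, ((if a = r then 1 else 0) * ξ s - (if a = s then 1 else 0) * ξ r) *
            contrEps ξ r s d := by
        simp only [Finset.mul_sum, ← Finset.sum_add_distrib]
        exact Finset.sum_congr rfl fun r _ => Finset.sum_congr rfl fun s _ => by
          rw [contrMT_qMedium]; ring
    _ = _ := by
        rw [hδ, sum_dualBV_mul_contrEps hA, sum_eps_mul_sum_eps_mul_contrEps]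
        ring

lemma sum_qMedium_mul_contrEps_mul_eps {A : BV} (hA : antisymBV A) (C₁ C₂ ρ : ℝ)
    (ξ : Fin 4 → ℝ) (a b c : Fin 4) :
    ∑ p, ∑ q, ∑ r, ∑ s, qMedium C₁ C₂ ρ A p q r s * contrEps ξ r s c * eps p q a b =
      4 * contrMT (qMedium C₁ C₂ ρ A) ξ c a b := by
  have hX : ∀ p q, ∑ r, ∑ s, idT p q r s * contrEps ξ r s c = 2 * contrEps ξ p q c :=
    fun p q => by
      have h : contrEps ξ q p c = -contrEps ξ p q c := by
        simp only [contrEps, eps_swap_left q p, neg_mul, Finset.sum_neg_distrib]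
      simp [idT, sub_mul, Finset.sum_sub_distrib, h]
      ring
  have hκ : ∀ p q, ∑ r, ∑ s, qMedium C₁ C₂ ρ A p q r s * contrEps ξ r s c * eps p q a b =
      C₁ * (sgn p * sgn q * eps p q a b) *
          (2 * ((if p = c then 1 else 0) * ξ q - (if q = c then 1 else 0) * ξ p)) +
        ρ * 4 * contrBV A ξ c * (eps a b p q * A p q) +
        C₂ * 2 * (eps a b p q * contrEps ξ p q c) := fun p q => by
    calc ∑ r, ∑ s, qMedium C₁ C₂ ρ A p q r s * contrEps ξ r s c * eps p q a b
        = C₁ * (sgn p * sgn q * eps p q a b) * (∑ r, ∑ s, eps p q r s * contrEps ξ r s c) +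
          ρ * A p q * eps p q a b * (∑ r, ∑ s, dualBV A r s * contrEps ξ r s c) +
          C₂ * eps p q a b * ∑ r, ∑ s, idT p q r s * contrEps ξ r s c := by
          simp only [qMedium_apply, Finset.mul_sum, ← Finset.sum_add_distrib]
          exact Finset.sum_congr rfl fun r _ => Finset.sum_congr rfl fun s _ => by ring
      _ = _ := by
          rw [hX, sum_dualBV_mul_contrEps hA, sum_eps_mul_contrEps, eps_swap_pairs a b]
          ring
  have hC : ∑ p, ∑ q, (sgn p * sgn q * eps p q a b) *
      (2 * ((if p = c then 1 else 0) * ξ q - (if q = c then 1 else 0) * ξ p)) =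
      4 * (sgn c * ∑ i, sgn i * ξ i * eps c i a b) := by
    have h : ∀ p, eps p c a b = -eps c p a b := fun p => eps_swap_left p c a b
    simp only [mul_sub, Finset.sum_sub_distrib]
    simp [h, Finset.mul_sum, ← Finset.sum_add_distrib]
    exact Finset.sum_congr rfl fun i _ => by ring
  simp only [hκ, Finset.sum_add_distrib, mul_assoc C₁, ← Finset.mul_sum, hC,
    sum_eps_mul_contrEps, contrMT_qMedium, dualBV]
  simp only [eq_comm (a := c)]
  ring

lemma antisymBV.exists_components {A : BV} (hA : antisymBV A) : ∃ a b c d e f : ℝ,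
    A = ![![0, a, b, c], ![-a, 0, d, e], ![-b, -d, 0, f], ![-c, -e, -f, 0]] := by
  refine ⟨A 0 1, A 0 2, A 0 3, A 1 2, A 1 3, A 2 3, ?_⟩
  ext i j
  fin_cases i <;> fin_cases j <;> simp <;> linarith [hA 0 0, hA 1 1, hA 2 2, hA 3 3, hA 0 1,
    hA 0 2, hA 0 3, hA 1 2, hA 1 3, hA 2 3]

lemma sum_contrBV_mul_eq_zero {A : BV} (hA : antisymBV A) (ξ : Fin 4 → ℝ) :
    ∑ i, contrBV A ξ i * ξ i = 0 := by
  obtain ⟨a, b, c, d, e, f, rfl⟩ := hA.exists_components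
  simp [contrBV, Fin.sum_univ_four]
  ring

/-- The covector `g_{aa'} A^{a'b} g_{bc} v^c` obtained from a vector `v` by lowering indices. -/
def lowerContrBV (A : BV) (v : Fin 4 → ℝ) (a : Fin 4) : ℝ := sgn a * ∑ b, A a b * (sgn b * v b)

/-- The Pfaffian of a bivector. -/
def pfaffBV (A : BV) : ℝ := A 0 1 * A 2 3 - A 0 2 * A 1 3 + A 0 3 * A 1 2

set_option maxHeartbeats 1000000 in
lemma sum_contrMT_qMedium_mul_contrMT_qMedium {A : BV} (hA : antisymBV A) (C₁ C₂ ρ : ℝ)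
    (ξ : Fin 4 → ℝ) (a d : Fin 4) :
    ∑ b, ∑ c, contrMT (qMedium C₁ C₂ ρ A) ξ c a b * contrMT (qMedium C₁ C₂ ρ A) ξ b c d =
      -2 * C₁ ^ 2 * ((if a = d then sgn a else 0) * ∑ i, sgn i * ξ i ^ 2 - ξ a * ξ d) +
        4 * C₁ * ρ * (sgn a * contrBV A ξ a * (sgn d * contrBV A ξ d) -
          (if a = d then sgn a else 0) * ∑ i, sgn i * contrBV A ξ i ^ 2) -
        2 * C₁ * ρ * (lowerContrBV A (contrBV A ξ) a * ξ d +
          lowerContrBV A (contrBV A ξ) d * ξ a) -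
        (3 * C₂ ^ 2 + 4 * C₂ * ρ * pfaffBV A + 4 * ρ ^ 2 * pfaffBV A ^ 2) * (ξ a * ξ d) := by
  obtain ⟨a', b', c', d', e', f', rfl⟩ := hA.exists_components
  fin_cases a <;> fin_cases d <;>
    simp [contrMT_qMedium, Fin.sum_univ_four, sgn, eps, dualBV, contrBV, lowerContrBV, pfaffBV] <;>
    ring

lemma sum_mul_lorentz_forms (C₁ ρ l : ℝ) (ξ v w : Fin 4 → ℝ) (h : ∑ i, v i * ξ i = 0) :
    ∑ a, ∑ d,
      (2 * C₁ * (sgn a * ((if a = d then 1 else 0) * ∑ i, sgn i * ξ i ^ 2 - sgn d * ξ d * ξ a)) +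
        4 * ρ * (v a * v d)) *
      (-2 * C₁ ^ 2 * ((if a = d then sgn a else 0) * ∑ i, sgn i * ξ i ^ 2 - ξ a * ξ d) +
        4 * C₁ * ρ * (sgn a * v a * (sgn d * v d) -
          (if a = d then sgn a else 0) * ∑ i, sgn i * v i ^ 2) -
        2 * C₁ * ρ * (w a * ξ d + w d * ξ a) - l * (ξ a * ξ d)) =
      -12 * C₁ ^ 2 * (∑ i, sgn i * ξ i ^ 2) *
        (C₁ * (∑ i, sgn i * ξ i ^ 2) + 2 * ρ * ∑ i, sgn i * v i ^ 2) := by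
  simp [Fin.sum_univ_four, sgn] at h ⊢
  linear_combination (-16 * C₁ * ρ ^ 2 * (v 0 * w 0 + v 1 * w 1 + v 2 * w 2 + v 3 * w 3) -
    4 * ρ * l * (v 0 * ξ 0 + v 1 * ξ 1 + v 2 * ξ 2 + v 3 * ξ 3)) * h

lemma sum_mul_mul_contr (P : Fin 4 → Fin 4 → Fin 4 → ℝ) (T : Fin 4 → Fin 4 → ℝ) :
    (1 / 48) * ∑ a, ∑ b, ∑ c, ∑ d, 4 * P c a b * T a d * P b c d =
      (1 / 12) * ∑ a, ∑ d, T a d * ∑ b, ∑ c, P c a b * P b c d := by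
  simp only [Finset.mul_sum, ← Fintype.sum_prod_type']
  refine Fintype.sum_equiv ⟨fun (a, b, c, d) => (a, d, b, c), fun (a, d, b, c) => (a, b, c, d),
    fun _ => rfl, fun _ => rfl⟩ _ _ fun _ => ?_
  simp only [Equiv.coe_fn_mk]
  ring

/-- Fresnel polynomial of generalized Q-media: for
κ^{ij}_{rs} = C₁ g^{ia} g^{jb} ε_{abrs} + ρ ε_{rsab} A^{ab} A^{ij} + C₂ Id^{ij}_{rs}
with g = diag(−1,1,1,1), one has
G(ξ) = −C₁²·(g^{ij}ξ_iξ_j)·(H^{ij}ξ_iξ_j) where H^{ij} = C₁g^{ij} − 2ρ A^{ia}g_{ab}A^{bj}. -/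
theorem stmt12 (C₁ C₂ ρ : ℝ) (A : BV) (hA : antisymBV A) :
    ∀ ξ : Fin 4 → ℝ,
      fresnel (fun i j r s =>
          C₁ * (∑ a, ∑ b, gmink i a * gmink j b * eps a b r s) +
            ρ * (∑ a, ∑ b, eps r s a b * A a b) * A i j + C₂ * idT i j r s) ξ =
        -C₁ ^ 2 * (∑ i, ∑ j, gmink i j * ξ i * ξ j) *
          (∑ i, ∑ j, (C₁ * gmink i j - 2 * ρ * ∑ a, ∑ b, A i a * gmink a b * A b j) *
            ξ i * ξ j) := by
  intro ξ
  change fresnel (qMedium C₁ C₂ ρ A) ξ = _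
  have hg : ∑ i, ∑ j, gmink i j * ξ i * ξ j = ∑ i, sgn i * ξ i ^ 2 := by
    simp [gmink_eq, pow_two, mul_assoc]
  have hH : ∑ i, ∑ j, (C₁ * gmink i j - 2 * ρ * ∑ a, ∑ b, A i a * gmink a b * A b j) *
      ξ i * ξ j = C₁ * (∑ i, sgn i * ξ i ^ 2) + 2 * ρ * ∑ i, sgn i * contrBV A ξ i ^ 2 := by
    obtain ⟨a, b, c, d, e, f, rfl⟩ := hA.exists_components
    simp [Fin.sum_univ_four, gmink, sgn, contrBV]
    ring
  rw [hg, hH]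
  calc fresnel (qMedium C₁ C₂ ρ A) ξ
      = (1 / 12) * ∑ a, ∑ d,
          (∑ r, ∑ s, contrMT (qMedium C₁ C₂ ρ A) ξ a r s * contrEps ξ r s d) *
            ∑ b, ∑ c, contrMT (qMedium C₁ C₂ ρ A) ξ c a b *
              contrMT (qMedium C₁ C₂ ρ A) ξ b c d := by
        simp only [fresnel_eq_sum_contr, sum_qMedium_mul_contrEps_mul_eps hA]
        exact sum_mul_mul_contr (contrMT (qMedium C₁ C₂ ρ A) ξ) fun a d =>
          ∑ r, ∑ s, contrMT (qMedium C₁ C₂ ρ A) ξ a r s * contrEps ξ r s d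
    _ = _ := by
        simp only [sum_contrMT_qMedium_mul_contrEps hA,
          sum_contrMT_qMedium_mul_contrMT_qMedium hA,
          sum_mul_lorentz_forms _ _ _ _ _ _ (sum_contrBV_mul_eq_zero hA ξ)]
        ring
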